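/- arXiv:1605.08224 — 4 statements merged into one kernel-verified Lean document; each statement's English description precedes it below -/
import Mathlib

section
/- Let λ ≥ 0 and t ∈ (√2/2, 1] with (1+λ)² − 4(λ+λ²)t² ≠ 0, and let f ∈ H_Σ(λ,t) have Taylor coefficients aₙ = f⁽ⁿ⁾(0)/n!. Then |a₂| ≤ 2t√(2t) / √(|(1+λ)² − 4(λ+λ²)t²|). -/
/-- The open unit disk in ℂ. -/
def unitD : Set ℂ := {z : ℂ | ‖z‖ < 1}

/-- The generating function `H(z,t) = 1 / (1 - 2 t z + z²)`. -/
noncomputable def Hker (t : ℝ) (z : ℂ) : ℂ := 1 / (1 - 2 * (t : ℂ) * z + z ^ 2)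

/-- `F` is subordinate to `H(·, t)` on the unit disk. -/
def SubordH (t : ℝ) (F : ℂ → ℂ) : Prop :=
  ∃ ω : ℂ → ℂ, AnalyticOnNhd ℂ ω unitD ∧ ω 0 = 0 ∧ (∀ z ∈ unitD, ‖ω z‖ < 1) ∧
    ∀ z ∈ unitD, F z = Hker t (ω z)

/-- The expression `(1-λ) z f'(z)/f(z) + λ (1 + z f''(z)/f'(z))`. -/
noncomputable def exprH (lam : ℝ) (f : ℂ → ℂ) (z : ℂ) : ℂ :=
  (1 - (lam : ℂ)) * (z * deriv f z / f z) +
    (lam : ℂ) * (1 + z * deriv (deriv f) z / deriv f z)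

/-- The analytic extension (with value 1 at 0) of `exprH lam f` is subordinate to `H(·,t)`. -/
def SubordExprH (lam t : ℝ) (f : ℂ → ℂ) : Prop :=
  ∃ F : ℂ → ℂ, AnalyticOnNhd ℂ F unitD ∧ F 0 = 1 ∧
    (∀ z ∈ unitD, z ≠ 0 → F z = exprH lam f z) ∧ SubordH t F

/-- `f` is bi-univalent on the unit disk with (bi-univalent) inverse `g`. -/
def BiUnivalentWithInv (f g : ℂ → ℂ) : Prop :=
  AnalyticOnNhd ℂ f unitD ∧ f 0 = 0 ∧ deriv f 0 = 1 ∧ Set.InjOn f unitD ∧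
  AnalyticOnNhd ℂ g unitD ∧ Set.InjOn g unitD ∧
  (∀ z ∈ unitD, f z ∈ unitD → g (f z) = z) ∧
  (∀ w ∈ unitD, g w ∈ unitD → f (g w) = w)

/-- The class `H_Σ(λ, t)`. -/
def InHSigma (lam t : ℝ) (f : ℂ → ℂ) : Prop :=
  ∃ g : ℂ → ℂ, BiUnivalentWithInv f g ∧ SubordExprH lam t f ∧ SubordExprH lam t g

open Filter Topology

/-- `f z = c₀ + c₁ z + c₂ z² + O(z³)` near `0`, with a continuous remainder. -/
def HasJet (f : ℂ → ℂ) (c₀ c₁ c₂ : ℂ) : Prop :=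
  ∃ r : ℂ → ℂ, ContinuousAt r 0 ∧ ∀ᶠ z in 𝓝 0, f z = c₀ + c₁ * z + c₂ * z ^ 2 + z ^ 3 * r z

namespace HasJet

variable {f g : ℂ → ℂ} {c₀ c₁ c₂ d₀ d₁ d₂ : ℂ}

lemma const (c : ℂ) : HasJet (fun _ => c) c 0 0 :=
  ⟨fun _ => 0, continuousAt_const, by simp⟩

lemma coord : HasJet (fun z => z) 0 1 0 :=
  ⟨fun _ => 0, continuousAt_const, by simp⟩

lemma add (hf : HasJet f c₀ c₁ c₂) (hg : HasJet g d₀ d₁ d₂) :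
    HasJet (fun z => f z + g z) (c₀ + d₀) (c₁ + d₁) (c₂ + d₂) := by
  obtain ⟨r, hr, hf⟩ := hf
  obtain ⟨s, hs, hg⟩ := hg
  refine ⟨fun z => r z + s z, hr.add hs, ?_⟩
  filter_upwards [hf, hg] with z h1 h2
  rw [h1, h2]
  ring

lemma mul (hf : HasJet f c₀ c₁ c₂) (hg : HasJet g d₀ d₁ d₂) :
    HasJet (fun z => f z * g z) (c₀ * d₀) (c₀ * d₁ + c₁ * d₀)
      (c₀ * d₂ + c₁ * d₁ + c₂ * d₀) := by
  obtain ⟨r, hr, hf⟩ := hf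
  obtain ⟨s, hs, hg⟩ := hg
  refine ⟨fun z => c₁ * d₂ + c₂ * d₁ + c₂ * d₂ * z + (c₀ + c₁ * z + c₂ * z ^ 2) * s z +
    (d₀ + d₁ * z + d₂ * z ^ 2) * r z + z ^ 3 * (r z * s z), by fun_prop, ?_⟩
  filter_upwards [hf, hg] with z h1 h2
  rw [h1, h2]
  ring

lemma continuousAt (hf : HasJet f c₀ c₁ c₂) : ContinuousAt f 0 := by
  obtain ⟨r, hr, hf⟩ := hf
  refine ContinuousAt.congr ?_ (hf.mono fun z hz => hz.symm)
  fun_prop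

lemma apply_zero (hf : HasJet f c₀ c₁ c₂) : f 0 = c₀ := by
  obtain ⟨r, hr, hf⟩ := hf
  simpa using hf.self_of_nhds

lemma eventually_ne_zero (hf : HasJet f c₀ c₁ c₂) (h : c₀ ≠ 0) : ∀ᶠ z in 𝓝 0, f z ≠ 0 :=
  hf.continuousAt.eventually_ne (by rwa [hf.apply_zero])

lemma comp (hg : HasJet g d₀ d₁ d₂) (hf : HasJet f 0 c₁ c₂) :
    HasJet (fun z => g (f z)) d₀ (d₁ * c₁) (d₁ * c₂ + d₂ * c₁ ^ 2) := by
  have hfc := hf.continuousAt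
  have hf0 := hf.apply_zero
  obtain ⟨r, hr, hf⟩ := hf
  obtain ⟨s, hs, hg⟩ := hg
  have hsf : ContinuousAt (fun z => s (f z)) 0 :=
    ContinuousAt.comp (g := s) (f := f) (by rwa [hf0]) hfc
  have hgf := hfc.eventually (p := fun w => g w = d₀ + d₁ * w + d₂ * w ^ 2 + w ^ 3 * s w)
    (by rwa [hf0])
  refine ⟨fun z => d₁ * r z + d₂ * (2 * c₁ * c₂ + c₂ ^ 2 * z + 2 * (c₁ + c₂ * z) * z * r z +
    z ^ 3 * r z ^ 2) + (c₁ + c₂ * z + z ^ 2 * r z) ^ 3 * s (f z),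
    .add (by fun_prop) (.mul (by fun_prop) hsf), ?_⟩
  filter_upwards [hf, hgf] with z h1 h2
  rw [h2]
  generalize s (f z) = S
  rw [h1]
  ring

lemma unique (hf : HasJet f c₀ c₁ c₂) (hg : HasJet g d₀ d₁ d₂) (h : f =ᶠ[𝓝[≠] 0] g) :
    c₀ = d₀ ∧ c₁ = d₁ ∧ c₂ = d₂ := by
  obtain ⟨r, hr, hf⟩ := hf
  obtain ⟨s, hs, hg⟩ := hg
  have eq_at_zero : ∀ {u v : ℂ → ℂ}, ContinuousAt u 0 → ContinuousAt v 0 →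
      u =ᶠ[𝓝[≠] 0] v → u 0 = v 0 := fun hu hv huv =>
    tendsto_nhds_unique ((hu.tendsto.mono_left nhdsWithin_le_nhds).congr' huv)
      (hv.tendsto.mono_left nhdsWithin_le_nhds)
  have key : ∀ᶠ z in 𝓝[≠] (0 : ℂ), c₀ + c₁ * z + c₂ * z ^ 2 + z ^ 3 * r z =
      d₀ + d₁ * z + d₂ * z ^ 2 + z ^ 3 * s z := by
    filter_upwards [h, hf.filter_mono nhdsWithin_le_nhds, hg.filter_mono nhdsWithin_le_nhds]
      with z h1 h2 h3
    rw [← h2, ← h3, h1]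
  have e0 : c₀ = d₀ := by
    simpa using eq_at_zero (u := fun z => c₀ + c₁ * z + c₂ * z ^ 2 + z ^ 3 * r z)
      (v := fun z => d₀ + d₁ * z + d₂ * z ^ 2 + z ^ 3 * s z) (by fun_prop) (by fun_prop) key
  subst e0
  have e1 : c₁ = d₁ := by
    have := eq_at_zero (u := fun z => c₁ + c₂ * z + z ^ 2 * r z)
      (v := fun z => d₁ + d₂ * z + z ^ 2 * s z) (by fun_prop) (by fun_prop) (by
        filter_upwards [key, self_mem_nhdsWithin] with z h1 hz
        exact mul_left_cancel₀ hz (by linear_combination h1))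
    simpa using this
  subst e1
  have e2 : c₂ = d₂ := by
    have := eq_at_zero (u := fun z => c₂ + z * r z)
      (v := fun z => d₂ + z * s z) (by fun_prop) (by fun_prop) (by
        filter_upwards [key, self_mem_nhdsWithin] with z h1 hz
        exact mul_left_cancel₀ (pow_ne_zero 2 hz) (by linear_combination h1))
    simpa using this
  exact ⟨rfl, rfl, e2⟩

end HasJet

lemma eq_add_mul_dslope (f : ℂ → ℂ) (z : ℂ) : f z = f 0 + z * dslope f 0 z := by
  have h := sub_smul_dslope f 0 z
  simp only [sub_zero, smul_eq_mul] at h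
  rw [h]
  ring

lemma AnalyticAt.dslope_zero {f : ℂ → ℂ} (hf : AnalyticAt ℂ f 0) :
    AnalyticAt ℂ (dslope f 0) 0 := by
  obtain ⟨p, hp⟩ := hf
  exact ⟨_, hp.has_fpower_series_dslope_fslope⟩

lemma AnalyticAt.eventually_deriv_eq_dslope {f : ℂ → ℂ} (hf : AnalyticAt ℂ f 0) :
    ∀ᶠ z in 𝓝 0, deriv f z = dslope f 0 z + z * deriv (dslope f 0) z := by
  filter_upwards [hf.dslope_zero.eventually_analyticAt] with z hz
  have h := ((hasDerivAt_id z).mul hz.differentiableAt.hasDerivAt).const_add (f 0)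
  have hfun : f = fun z => f 0 + ((id : ℂ → ℂ) * dslope f 0) z :=
    funext fun w => eq_add_mul_dslope f w
  have := h.deriv
  rw [← hfun] at this
  simpa using this

lemma AnalyticAt.eventually_deriv_deriv_eq_dslope {f : ℂ → ℂ} (hf : AnalyticAt ℂ f 0) :
    ∀ᶠ z in 𝓝 0, deriv (deriv f) z =
      2 * deriv (dslope f 0) z + z * deriv (deriv (dslope f 0)) z := by
  filter_upwards [hf.dslope_zero.eventually_analyticAt,
    hf.eventually_deriv_eq_dslope.eventually_nhds] with z hz hd
  have h := hz.differentiableAt.hasDerivAt.add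
    ((hasDerivAt_id z).mul hz.deriv.differentiableAt.hasDerivAt)
  have hd' : deriv f =ᶠ[𝓝 z] dslope f 0 + id * deriv (dslope f 0) := hd
  rw [hd'.deriv_eq, h.deriv, id]
  ring

lemma AnalyticAt.hasJet {f : ℂ → ℂ} (hf : AnalyticAt ℂ f 0) :
    HasJet f (f 0) (deriv f 0) (deriv (deriv f) 0 / 2) := by
  have h2 : deriv (deriv f) 0 = 2 * deriv (dslope f 0) 0 := by
    simpa using hf.eventually_deriv_deriv_eq_dslope.self_of_nhds
  refine ⟨dslope (dslope (dslope f 0) 0) 0,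
    hf.dslope_zero.dslope_zero.dslope_zero.continuousAt, Eventually.of_forall fun z => ?_⟩
  rw [h2, eq_add_mul_dslope f z, eq_add_mul_dslope (dslope f 0) z,
    eq_add_mul_dslope (dslope (dslope f 0) 0) z]
  simp only [dslope_same]
  ring

lemma zero_mem_unitD : (0 : ℂ) ∈ unitD := by simp [unitD]

lemma unitD_mem_nhds : unitD ∈ 𝓝 (0 : ℂ) :=
  (isOpen_lt continuous_norm continuous_const).mem_nhds zero_mem_unitD

/-- Cauchy's estimate for the second Taylor coefficient of a self-map of the disk. -/
lemma norm_deriv_deriv_zero_le {ω : ℂ → ℂ} (hω : AnalyticOnNhd ℂ ω unitD)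
    (hb : ∀ z ∈ unitD, ‖ω z‖ < 1) : ‖deriv (deriv ω) 0 / 2‖ ≤ 1 := by
  have key : ∀ R : ℝ, 0 < R → R < 1 → ‖deriv (deriv ω) 0 / 2‖ * R ^ 2 ≤ 1 := by
    intro R hR hR1
    have hsub : Metric.closedBall (0 : ℂ) R ⊆ unitD := fun z hz => by
      have : ‖z‖ ≤ R := by simpa using hz
      exact this.trans_lt hR1
    have hd : DiffContOnCl ℂ ω (Metric.ball 0 R) := by
      refine DifferentiableOn.diffContOnCl ?_
      rw [closure_ball _ hR.ne']
      exact hω.differentiableOn.mono hsub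
    have h := Complex.norm_iteratedDeriv_le_of_forall_mem_sphere_norm_le 2 hR hd
      (C := 1) fun z hz => (hb z (hsub (Metric.sphere_subset_closedBall hz))).le
    rw [iteratedDeriv_succ, iteratedDeriv_one, le_div_iff₀ (by positivity)] at h
    rw [norm_div, Complex.norm_ofNat]
    norm_num at h
    linarith
  have hlim : Tendsto (fun R : ℝ => ‖deriv (deriv ω) 0 / 2‖ * R ^ 2) (𝓝[<] 1)
      (𝓝 (‖deriv (deriv ω) 0 / 2‖ * 1 ^ 2)) :=
    Tendsto.mono_left (Continuous.tendsto (by fun_prop) 1) nhdsWithin_le_nhds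
  have := le_of_tendsto hlim (by
    filter_upwards [Ioo_mem_nhdsLT (zero_lt_one' ℝ)] with R hR using key R hR.1 hR.2)
  simpa using this

/-- Comparison of the first two Taylor coefficients in the subordination, where
`dslope f 0 z = f z / z = 1 + a₂ z + a₃ z² + ⋯`. -/
lemma SubordExprH.coeff_eqs {lam t : ℝ} {f : ℂ → ℂ} (hf : AnalyticAt ℂ f 0) (hf0 : f 0 = 0)
    (hf1 : deriv f 0 = 1) (h : SubordExprH lam t f) {a₂ a₃ : ℂ}
    (hp : HasJet (dslope f 0) 1 a₂ a₃) :
    ∃ c₁ c₂ : ℂ, ‖c₂‖ ≤ 1 ∧ (1 + lam) * a₂ = 2 * t * c₁ ∧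
      2 * (1 + 2 * lam) * a₃ - (1 + 3 * lam) * a₂ ^ 2 = 2 * t * c₂ + (4 * t ^ 2 - 1) * c₁ ^ 2 := by
  obtain ⟨F, -, -, hFe, ω, hω, hω0, hωb, hFω⟩ := h
  have hωa := hω 0 zero_mem_unitD
  refine ⟨deriv ω 0, _, norm_deriv_deriv_zero_le hω hωb, ?_⟩
  have jω := hωa.hasJet
  have hpa := hf.dslope_zero
  obtain ⟨-, e₂, e₃⟩ := hp.unique hpa.hasJet EventuallyEq.rfl
  have jq := HasJet.coord.mul hpa.deriv.hasJet
  have js := HasJet.coord.mul (HasJet.coord.mul hpa.deriv.deriv.hasJet)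
  rw [hω0] at jω
  have hd1 := hf.eventually_deriv_eq_dslope
  have hd2 := hf.eventually_deriv_deriv_eq_dslope
  generalize deriv ω 0 = c₁ at *
  generalize deriv (deriv ω) 0 / 2 = c₂ at *
  have jden := ((HasJet.const 1).add ((HasJet.const (-2 * t)).mul jω)).add (jω.mul jω)
  have jf' := hp.add jq
  have jzf'' := ((HasJet.const 2).mul jq).add js
  have jE := ((HasJet.const (1 - lam)).mul (jf'.mul jf')).add
    ((HasJet.const lam).mul ((hp.mul jf').add (hp.mul jzf'')))
  have hp0 := hp.eventually_ne_zero one_ne_zero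
  have hf'0 : ∀ᶠ z in 𝓝 0, deriv f z ≠ 0 :=
    hf.deriv.continuousAt.eventually_ne (by simp [hf1])
  have hden0 := jden.eventually_ne_zero (by simp)
  obtain ⟨-, h1, h2⟩ := (jden.mul jE).unique (hp.mul jf') (by
    filter_upwards [hp0.filter_mono nhdsWithin_le_nhds, hf'0.filter_mono nhdsWithin_le_nhds,
      hden0.filter_mono nhdsWithin_le_nhds, hd1.filter_mono nhdsWithin_le_nhds,
      hd2.filter_mono nhdsWithin_le_nhds, nhdsWithin_le_nhds unitD_mem_nhds,
      self_mem_nhdsWithin] with z k1 k2 k3 k4 k5 k6 k7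
    have k7 : z ≠ 0 := k7
    have hF := hFe z k6 k7
    rw [hFω z k6, Hker, exprH, eq_add_mul_dslope f z, hf0, zero_add] at hF
    have hden : 1 - 2 * (t : ℂ) * ω z + ω z ^ 2 ≠ 0 := by
      convert k3 using 1
      ring
    have hz : z * deriv (deriv f) z = 2 * (z * deriv (dslope f 0) z) +
      z * (z * deriv (deriv (dslope f 0)) z) := by rw [k5]; ring
    rw [← k4, ← hz]
    field_simp at hF
    linear_combination -hF)
  have h1' : (1 + lam) * a₂ = 2 * t * c₁ := by
    rw [← e₂] at h1
    linear_combination h1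
  refine ⟨h1', ?_⟩
  rw [← e₂] at h2
  have e₃' : deriv (deriv (dslope f 0)) 0 = 2 * a₃ := by rw [e₃]; ring
  rw [e₃'] at h2
  linear_combination h2 + (2 * t * c₁ - 3 * a₂) * h1'

/-- The Taylor coefficients of a local left inverse. -/
lemma inverse_coeffs {f g : ℂ → ℂ} (hf0 : f 0 = 0) (hg0 : g 0 = 0)
    (h : ∀ᶠ z in 𝓝 0, g (f z) = z) {a₂ a₃ b₁ b₂ b₃ : ℂ}
    (hp : HasJet (dslope f 0) 1 a₂ a₃) (hq : HasJet (dslope g 0) b₁ b₂ b₃) :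
    b₁ = 1 ∧ b₂ = -a₂ ∧ b₃ = 2 * a₂ ^ 2 - a₃ := by
  have jf : HasJet f 0 1 a₂ := by
    have := HasJet.coord.mul hp
    have hfun : (fun z => z * dslope f 0 z) = f :=
      funext fun z => by rw [eq_add_mul_dslope f z, hf0, zero_add]
    rw [hfun] at this
    convert this using 1 <;> ring
  obtain ⟨h0, h1, h2⟩ := ((hq.comp jf).mul hp).unique (HasJet.const 1) (by
    filter_upwards [h.filter_mono nhdsWithin_le_nhds, self_mem_nhdsWithin] with z hz hz0
    rw [eq_add_mul_dslope g, hg0, zero_add] at hz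
    refine mul_left_cancel₀ (show z ≠ 0 from hz0) ?_
    have hfz := eq_add_mul_dslope f z
    rw [hf0, zero_add] at hfz
    linear_combination hz - dslope g 0 (f z) * hfz)
  have hb1 : b₁ = 1 := by simpa using h0
  subst hb1
  have hb2 : b₂ = -a₂ := by linear_combination h1
  subst hb2
  exact ⟨rfl, rfl, by linear_combination h2⟩

theorem hsigma_a2_bound (lam t : ℝ) (hlam : 0 ≤ lam)
    (ht : t ∈ Set.Ioc (Real.sqrt 2 / 2) 1)
    (hne : (1 + lam) ^ 2 - 4 * (lam + lam ^ 2) * t ^ 2 ≠ 0)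
    (f : ℂ → ℂ) (hf : InHSigma lam t f)
    (a : ℕ → ℂ) (ha : ∀ n, a n = iteratedDeriv n f 0 / n.factorial) :
    ‖a 2‖ ≤ 2 * t * Real.sqrt (2 * t) /
      Real.sqrt |(1 + lam) ^ 2 - 4 * (lam + lam ^ 2) * t ^ 2| := by
  obtain ⟨g, ⟨hfa, hf0, hf1, -, hga, -, hgf, -⟩, hSf, hSg⟩ := hf
  have hfa := hfa 0 zero_mem_unitD
  have hga := hga 0 zero_mem_unitD
  have hg0 : g 0 = 0 := by
    simpa [hf0] using hgf 0 zero_mem_unitD (by simpa [hf0] using zero_mem_unitD)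
  have hgf' : ∀ᶠ z in 𝓝 0, g (f z) = z := by
    filter_upwards [unitD_mem_nhds,
      hfa.continuousAt.preimage_mem_nhds (by rw [hf0]; exact unitD_mem_nhds)] with z hz hfz
    exact hgf z hz hfz
  have ha2 : a 2 = deriv (dslope f 0) 0 := by
    have := hfa.eventually_deriv_deriv_eq_dslope.self_of_nhds
    rw [ha, iteratedDeriv_succ, iteratedDeriv_one, this]
    simp [Nat.factorial]
  have jp := hfa.dslope_zero.hasJet
  have jq := hga.dslope_zero.hasJet
  rw [dslope_same, hf1, ← ha2] at jp
  obtain ⟨hb1, hb2, hb3⟩ := inverse_coeffs hf0 hg0 hgf' jp jq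
  rw [hb1, hb2, hb3] at jq
  rw [dslope_same] at hb1
  obtain ⟨c₁, c₂, hc, h1, h2⟩ := hSf.coeff_eqs hfa hf0 hf1 jp
  obtain ⟨d₁, d₂, hd, h3, h4⟩ := hSg.coeff_eqs hga hg0 hb1 jq
  have hK : a 2 ^ 2 * (((1 + lam) ^ 2 - 4 * (lam + lam ^ 2) * t ^ 2 : ℝ) : ℂ) =
      ((4 * t ^ 3 : ℝ) : ℂ) * (c₂ + d₂) := by
    push_cast
    linear_combination 2 * t ^ 2 * h2 + 2 * t ^ 2 * h4 -
      (4 * t ^ 2 - 1) / 2 * (((1 + lam) * a 2 + 2 * t * c₁) * h1 +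
        (-(1 + lam) * a 2 + 2 * t * d₁) * h3)
  have ht0 : 0 < t := lt_trans (by positivity) ht.1
  have hn := congrArg norm hK
  rw [norm_mul, norm_mul, norm_pow, Complex.norm_real, Complex.norm_real, Real.norm_eq_abs,
    Real.norm_of_nonneg (by positivity : 0 ≤ 4 * t ^ 3)] at hn
  have hcd : ‖c₂ + d₂‖ ≤ 2 := (norm_add_le _ _).trans (by linarith)
  have hbound : ‖a 2‖ ^ 2 * |(1 + lam) ^ 2 - 4 * (lam + lam ^ 2) * t ^ 2| ≤ 8 * t ^ 3 := by
    rw [hn]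
    nlinarith [pow_pos ht0 3]
  rw [le_div_iff₀ (Real.sqrt_pos.2 (abs_pos.2 hne))]
  refine le_of_sq_le_sq ?_ (by positivity)
  rw [mul_pow, mul_pow, Real.sq_sqrt (abs_nonneg _), Real.sq_sqrt (by positivity)]
  linarith
end

section
/- Let λ ≥ 0 and t ∈ (√2/2, 1], let f ∈ H_Σ(λ,t) have Taylor coefficients aₙ = f⁽ⁿ⁾(0)/n!, and let μ ∈ ℝ. If |μ − 1| ≤ (1/(8(1+2λ)))·|(1+λ)²/t² − 4λ(1+λ)|, then |a₃ − μ·a₂²| ≤ t/(1+2λ). -/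
open Filter Topology

/-- `f z = a + b z + c z² + z³ S z` on a punctured neighbourhood of `0`, with `S` continuous
at `0`. -/
def HasTwoJet (f : ℂ → ℂ) (a b c : ℂ) : Prop :=
  ∃ S : ℂ → ℂ, ContinuousAt S 0 ∧
    ∀ᶠ z in 𝓝[≠] (0 : ℂ), f z = a + b * z + c * z ^ 2 + z ^ 3 * S z

namespace HasTwoJet

variable {f g : ℂ → ℂ} {a b c a' b' c' : ℂ}

lemma congr (hf : HasTwoJet f a b c) (h : ∀ᶠ z in 𝓝[≠] (0 : ℂ), g z = f z) :
    HasTwoJet g a b c := by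
  obtain ⟨S, hS, hfS⟩ := hf
  exact ⟨S, hS, by filter_upwards [hfS, h] with z h₁ h₂ using h₂.trans h₁⟩

lemma const (a : ℂ) : HasTwoJet (fun _ => a) a 0 0 :=
  ⟨fun _ => 0, continuousAt_const, by simp⟩

lemma id_jet : HasTwoJet (fun z => z) 0 1 0 :=
  ⟨fun _ => 0, continuousAt_const, by simp⟩

lemma add (hf : HasTwoJet f a b c) (hg : HasTwoJet g a' b' c') :
    HasTwoJet (fun z => f z + g z) (a + a') (b + b') (c + c') := by
  obtain ⟨S, hS, hfS⟩ := hf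
  obtain ⟨T, hT, hgT⟩ := hg
  refine ⟨fun z => S z + T z, hS.add hT, ?_⟩
  filter_upwards [hfS, hgT] with z h₁ h₂
  rw [h₁, h₂]; ring

lemma mul (hf : HasTwoJet f a b c) (hg : HasTwoJet g a' b' c') :
    HasTwoJet (fun z => f z * g z) (a * a') (a * b' + b * a') (a * c' + b * b' + c * a') := by
  obtain ⟨S, hS, hfS⟩ := hf
  obtain ⟨T, hT, hgT⟩ := hg
  refine ⟨fun z => b * c' + c * b' + c * c' * z + S z * (a' + b' * z + c' * z ^ 2)
    + T z * (a + b * z + c * z ^ 2) + z ^ 3 * S z * T z, by fun_prop, ?_⟩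
  filter_upwards [hfS, hgT] with z h₁ h₂
  rw [h₁, h₂]; ring

lemma tendsto (hf : HasTwoJet f a b c) : Tendsto f (𝓝[≠] 0) (𝓝 a) := by
  obtain ⟨S, hS, hfS⟩ := hf
  have h : ContinuousAt (fun z => a + b * z + c * z ^ 2 + z ^ 3 * S z) 0 := by fun_prop
  have h' := h.tendsto.mono_left (nhdsWithin_le_nhds (s := {0}ᶜ))
  simp only [mul_zero, add_zero, ne_eq, OfNat.ofNat_ne_zero, not_false_eq_true, zero_pow,
    zero_mul] at h'
  exact h'.congr' (hfS.mono fun z hz => hz.symm)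

lemma eventually_ne (hf : HasTwoJet f a b c) (ha : a ≠ 0) : ∀ᶠ z in 𝓝[≠] (0 : ℂ), f z ≠ 0 :=
  hf.tendsto.eventually_ne ha

lemma unique (hf : HasTwoJet f a b c) (hf' : HasTwoJet f a' b' c') :
    a = a' ∧ b = b' ∧ c = c' := by
  obtain rfl : a = a' := tendsto_nhds_unique hf.tendsto hf'.tendsto
  have hne : ∀ᶠ z in 𝓝[≠] (0 : ℂ), z ≠ 0 := eventually_mem_nhdsWithin
  obtain ⟨S, hS, hfS⟩ := hf
  obtain ⟨T, hT, hfT⟩ := hf'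
  have lim {k k' : ℂ} {U V : ℂ → ℂ} (hU : ContinuousAt U 0) (hV : ContinuousAt V 0)
      (h : ∀ᶠ z in 𝓝[≠] (0 : ℂ), k + z * U z = k' + z * V z) : k = k' := by
    have h₁ : ContinuousAt (fun z => k + z * U z) 0 := by fun_prop
    have h₂ : ContinuousAt (fun z => k' + z * V z) 0 := by fun_prop
    simpa using tendsto_nhds_unique
      ((h₁.tendsto.mono_left nhdsWithin_le_nhds).congr' h)
      (h₂.tendsto.mono_left nhdsWithin_le_nhds)
  obtain rfl : b = b' := by
    refine lim (U := fun z => c + z * S z) (V := fun z => c' + z * T z) (by fun_prop)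
      (by fun_prop) ?_
    filter_upwards [hfS, hfT, hne] with z h₁ h₂ hz
    apply mul_left_cancel₀ hz
    linear_combination h₂ - h₁
  refine ⟨rfl, rfl, lim hS hT ?_⟩
  filter_upwards [hfS, hfT, hne] with z h₁ h₂ hz
  apply mul_left_cancel₀ (pow_ne_zero 2 hz)
  linear_combination h₂ - h₁

end HasTwoJet

lemma AnalyticAt.hasTwoJet {f : ℂ → ℂ} (hf : AnalyticAt ℂ f 0) :
    HasTwoJet f (f 0) (deriv f 0) (iteratedDeriv 2 f 0 / 2) := by
  obtain ⟨S, hS, h⟩ := hf.exists_eq_sum_add_pow_mul 3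
  refine ⟨S, hS.continuousAt, Eventually.of_forall fun z => ?_⟩
  rw [h z]
  simp [Finset.sum_range_succ, Nat.factorial]
  ring

lemma AnalyticAt.hasTwoJet_div_self {f : ℂ → ℂ} (hf : AnalyticAt ℂ f 0) (h0 : f 0 = 0) :
    HasTwoJet (fun z => f z / z) (deriv f 0) (iteratedDeriv 2 f 0 / 2)
      (iteratedDeriv 3 f 0 / 6) := by
  obtain ⟨S, hS, h⟩ := hf.exists_eq_sum_add_pow_mul 4
  refine ⟨S, hS.continuousAt, ?_⟩
  filter_upwards [eventually_mem_nhdsWithin] with z hz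
  have hz : z ≠ 0 := hz
  rw [div_eq_iff hz, h z]
  simp [Finset.sum_range_succ, Nat.factorial, h0]
  ring

lemma unitD_eq_ball : unitD = Metric.ball 0 1 := by
  ext z; simp [unitD]

/-- Cauchy's bound for the second Taylor coefficient of a bounded function. -/
lemma norm_second_coeff_le_one {ω : ℂ → ℂ} (hω : AnalyticOnNhd ℂ ω unitD)
    (hb : ∀ z ∈ unitD, ‖ω z‖ < 1) : ‖iteratedDeriv 2 ω 0 / 2‖ ≤ 1 := by
  have key : ∀ r ∈ Set.Ioo (0 : ℝ) 1, ‖iteratedDeriv 2 ω 0 / 2‖ * r ^ 2 ≤ 1 := by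
    intro r hr
    have hsub : Metric.closedBall (0 : ℂ) r ⊆ unitD :=
      unitD_eq_ball ▸ Metric.closedBall_subset_ball hr.2
    have hd : DiffContOnCl ℂ ω (Metric.ball 0 r) := by
      apply DifferentiableOn.diffContOnCl
      rw [closure_ball _ hr.1.ne']
      exact (hω.mono hsub).differentiableOn
    have h := Complex.norm_iteratedDeriv_le_of_forall_mem_sphere_norm_le 2 hr.1 hd
      fun z hz => (hb z (hsub (Metric.sphere_subset_closedBall hz))).le
    rw [le_div_iff₀ (pow_pos hr.1 2)] at h
    norm_num [Nat.factorial] at h ⊢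
    linarith
  have hlim : Tendsto (fun r : ℝ => ‖iteratedDeriv 2 ω 0 / 2‖ * r ^ 2) (𝓝[<] 1)
      (𝓝 (‖iteratedDeriv 2 ω 0 / 2‖ * 1 ^ 2)) :=
    (Continuous.tendsto (by fun_prop) 1).mono_left nhdsWithin_le_nhds
  rw [one_pow, mul_one] at hlim
  exact le_of_tendsto hlim (by filter_upwards [Ioo_mem_nhdsLT one_pos] with r hr using key r hr)

/-- The coefficients of a function satisfying the subordination, in terms of those of the
Schwarz function. -/
lemma SubordExprH.coeff_relations {lam t : ℝ} {f : ℂ → ℂ} (hf : AnalyticAt ℂ f 0) (h0 : f 0 = 0)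
    (h1 : deriv f 0 = 1) (hs : SubordExprH lam t f) :
    ∃ c d : ℂ, ‖d‖ ≤ 1 ∧ (1 + lam) * (iteratedDeriv 2 f 0 / 2) = 2 * t * c ∧
      2 * (1 + 2 * lam) * (iteratedDeriv 3 f 0 / 6)
        - (1 + 3 * lam) * (iteratedDeriv 2 f 0 / 2) ^ 2 = 2 * t * d + (4 * t ^ 2 - 1) * c ^ 2 := by
  obtain ⟨F, hF, hF0, hFe, ω, hω, hω0, hωb, hFω⟩ := hs
  refine ⟨deriv ω 0, iteratedDeriv 2 ω 0 / 2, norm_second_coeff_le_one hω hωb, ?_⟩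
  have jω := (hω 0 zero_mem_unitD).hasTwoJet
  have jF := (hF 0 zero_mem_unitD).hasTwoJet
  have jp := hf.hasTwoJet_div_self h0
  have jd := hf.deriv.hasTwoJet
  have jdd := hf.deriv.deriv.hasTwoJet
  have e2 : deriv (deriv f) 0 = iteratedDeriv 2 f 0 := by
    rw [iteratedDeriv_succ', iteratedDeriv_one]
  have e3 : iteratedDeriv 2 (deriv f) 0 = iteratedDeriv 3 f 0 := by
    rw [iteratedDeriv_succ' (n := 2)]
  have e3' : deriv (deriv (deriv f)) 0 = iteratedDeriv 3 f 0 := by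
    rw [← e3, iteratedDeriv_succ', iteratedDeriv_one]
  rw [hω0] at jω
  rw [hF0] at jF
  rw [h1] at jp
  rw [h1, e2, e3] at jd
  rw [e2, e3'] at jdd
  have hD : ∀ᶠ z in 𝓝[≠] (0 : ℂ), z ∈ unitD := nhdsWithin_le_nhds unitD_mem_nhds
  have hne : ∀ᶠ z in 𝓝[≠] (0 : ℂ), z ≠ 0 := eventually_mem_nhdsWithin
  have jden := ((HasTwoJet.const 1).add ((HasTwoJet.const (-(2 * t))).mul jω)).add (jω.mul jω)
  have hH := ((jF.mul jden).congr (g := fun _ => 1) (by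
    filter_upwards [hD, jden.eventually_ne (by simp)] with z hz hz'
    have : Hker t (ω z) = 1 / (1 + -(2 * t) * ω z + ω z * ω z) := by
      rw [Hker]; congr 1; ring
    rw [hFω z hz, this, one_div_mul_cancel hz'])).unique (HasTwoJet.const 1)
  have hE := ((jF.mul (jp.mul jd)).congr
    (g := fun z => (1 - (lam : ℂ)) * (deriv f z * deriv f z)
      + lam * (f z / z * (deriv f z + z * deriv (deriv f) z))) (by
    filter_upwards [hD, hne, jp.eventually_ne one_ne_zero, jd.eventually_ne one_ne_zero]
      with z hz hz' hp hd
    have hfz : f z ≠ 0 := fun h => hp (by simp [h])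
    rw [hFe z hz hz', exprH]
    field_simp)).unique
    (((HasTwoJet.const (1 - (lam : ℂ))).mul (jd.mul jd)).add
      ((HasTwoJet.const (lam : ℂ)).mul (jp.mul (jd.add (HasTwoJet.id_jet.mul jdd)))))
  obtain ⟨-, hH1, hH2⟩ := hH
  obtain ⟨-, hE1, hE2⟩ := hE
  generalize deriv F 0 = F₁ at *
  generalize iteratedDeriv 2 F 0 = F₂ at *
  obtain rfl : F₁ = 2 * t * deriv ω 0 := by linear_combination hH1
  refine ⟨by linear_combination -hE1, ?_⟩
  linear_combination hH2 - hE2 + 3 / 2 * iteratedDeriv 2 f 0 * hE1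

/-- The second and third coefficients of the inverse function. -/
lemma coeff_of_leftInverse {f g : ℂ → ℂ} (hf : AnalyticAt ℂ f 0) (h0 : f 0 = 0)
    (h1 : deriv f 0 = 1) (hg : AnalyticAt ℂ g 0) (hgf : ∀ᶠ z in 𝓝 (0 : ℂ), g (f z) = z) :
    g 0 = 0 ∧ deriv g 0 = 1 ∧ iteratedDeriv 2 g 0 / 2 = -(iteratedDeriv 2 f 0 / 2) ∧
      iteratedDeriv 3 g 0 / 6 = 2 * (iteratedDeriv 2 f 0 / 2) ^ 2 - iteratedDeriv 3 f 0 / 6 := by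
  have hg0 : g 0 = 0 := by simpa [h0] using hgf.self_of_nhds
  obtain ⟨S, hS, hgS⟩ := hg.exists_eq_sum_add_pow_mul 4
  have hSf : AnalyticAt ℂ (fun z => S (f z)) 0 := AnalyticAt.fun_comp (by rwa [h0]) hf
  have jp := hf.hasTwoJet_div_self h0
  have jS := hSf.hasTwoJet
  have jz := HasTwoJet.id_jet
  rw [h1] at jp
  have jp2 := jp.mul jp
  have jp3 := jp2.mul jp
  have jp4 := jp3.mul jp
  have j := (((((HasTwoJet.const (deriv g 0)).mul jp).add
    ((HasTwoJet.const (iteratedDeriv 2 g 0 / 2)).mul (jz.mul jp2))).add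
    ((HasTwoJet.const (iteratedDeriv 3 g 0 / 6)).mul ((jz.mul jz).mul jp3))).add
    (((jz.mul jz).mul jz).mul (jp4.mul jS))).congr (g := fun _ => 1) (by
      have hne : ∀ᶠ z in 𝓝[≠] (0 : ℂ), z ≠ 0 := eventually_mem_nhdsWithin
      filter_upwards [hgf.filter_mono nhdsWithin_le_nhds, hne] with z hz hz'
      have h := hgS (f z)
      rw [hz] at h
      simp only [Finset.sum_range_succ, Finset.sum_range_zero, Nat.factorial, iteratedDeriv_zero,
        iteratedDeriv_one, hg0, smul_eq_mul] at h
      push_cast at h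
      apply mul_left_cancel₀ hz'
      field_simp
      linear_combination 12 * h)
  obtain ⟨h₀, h₁, h₂⟩ := j.unique (HasTwoJet.const 1)
  have hd : deriv g 0 = 1 := by linear_combination h₀
  rw [hd] at h₁ h₂
  have hb : iteratedDeriv 2 g 0 / 2 = -(iteratedDeriv 2 f 0 / 2) := by linear_combination h₁
  rw [hb] at h₂
  exact ⟨hg0, hd, hb, by linear_combination h₂⟩

lemma norm_add_mul_sub_mul_le {c d : ℂ} {h m : ℝ} (hc : ‖c‖ ≤ 1) (hd : ‖d‖ ≤ 1) (hh : |h| ≤ m) :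
    ‖(h + m : ℂ) * c + (h - m : ℂ) * d‖ ≤ 2 * m := by
  obtain ⟨h₁, h₂⟩ := abs_le.1 hh
  have e₁ : ‖(h + m : ℂ)‖ = h + m := by
    rw [← Complex.ofReal_add, Complex.norm_real, Real.norm_of_nonneg (by linarith)]
  have e₂ : ‖(h - m : ℂ)‖ = m - h := by
    rw [← Complex.ofReal_sub, Complex.norm_real, Real.norm_of_nonpos (by linarith)]; ring
  calc _ ≤ ‖(h + m : ℂ)‖ * ‖c‖ + ‖(h - m : ℂ)‖ * ‖d‖ := by
        simpa only [norm_mul] using norm_add_le ((h + m : ℂ) * c) ((h - m : ℂ) * d)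
    _ ≤ (h + m) * 1 + (m - h) * 1 := by
        rw [e₁, e₂]
        gcongr
        linarith
    _ = 2 * m := by ring

theorem hsigma_fekete_szego_small (lam t : ℝ) (hlam : 0 ≤ lam)
    (ht : t ∈ Set.Ioc (Real.sqrt 2 / 2) 1)
    (f : ℂ → ℂ) (hf : InHSigma lam t f)
    (a : ℕ → ℂ) (ha : ∀ n, a n = iteratedDeriv n f 0 / n.factorial)
    (μ : ℝ)
    (hμ : |μ - 1| ≤ 1 / (8 * (1 + 2 * lam)) *
      |(1 + lam) ^ 2 / t ^ 2 - 4 * lam * (1 + lam)|) :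
    ‖a 3 - (μ : ℂ) * (a 2) ^ 2‖ ≤ t / (1 + 2 * lam) := by
  obtain ⟨g, ⟨hfa, hf0, hf1, -, hga, -, hgf, -⟩, hsf, hsg⟩ := hf
  have hfa := hfa 0 zero_mem_unitD
  have hga := hga 0 zero_mem_unitD
  have hgf : ∀ᶠ z in 𝓝 (0 : ℂ), g (f z) = z := by
    have : ∀ᶠ z in 𝓝 (0 : ℂ), f z ∈ unitD :=
      hfa.continuousAt.eventually_mem (by rw [hf0]; exact unitD_mem_nhds)
    filter_upwards [unitD_mem_nhds, this] with z hz hz' using hgf z hz hz'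
  obtain ⟨hg0, hg1, hg2, hg3⟩ := coeff_of_leftInverse hfa hf0 hf1 hga hgf
  obtain ⟨c₁, c₂, hc, hf2, hf3⟩ := hsf.coeff_relations hfa hf0 hf1
  obtain ⟨d₁, d₂, hd, hg2', hg3'⟩ := hsg.coeff_relations hga hg0 hg1
  have ha2 : a 2 = iteratedDeriv 2 f 0 / 2 := by simp [ha]
  have ha3 : a 3 = iteratedDeriv 3 f 0 / 6 := by simp [ha, Nat.factorial]
  rw [hg2] at hg2'
  rw [hg2, hg3] at hg3'
  rw [← ha2] at hf2 hg2'
  rw [← ha2, ← ha3] at hf3 hg3'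
  have ht0 : 0 < t := lt_trans (by positivity) ht.1
  have htC : (t : ℂ) ≠ 0 := by exact_mod_cast ht0.ne'
  have hm : (0 : ℝ) < 1 + 2 * lam := by linarith
  have hmC : (1 + 2 * lam : ℂ) ≠ 0 := by exact_mod_cast hm.ne'
  set K : ℝ := (1 + lam) ^ 2 / t ^ 2 - 4 * lam * (1 + lam) with hK
  have hKC : (K : ℂ) = (1 + lam) ^ 2 / t ^ 2 - 4 * lam * (1 + lam) := by
    rw [hK]; push_cast; ring
  have hdc : d₁ = -c₁ := by
    apply mul_left_cancel₀ htC
    linear_combination (-hg2' - hf2) / 2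
  subst hdc
  have hc1 : c₁ = (1 + lam) * a 2 / (2 * t) := by
    rw [eq_div_iff (by simpa using htC)]
    linear_combination -hf2
  subst hc1
  have hsum : (K : ℂ) * a 2 ^ 2 = 4 * t * (c₂ + d₂) := by
    rw [hKC]
    field_simp at hf3 hg3' ⊢
    linear_combination (hf3 + hg3') / 2
  have hdiff : a 3 - a 2 ^ 2 = t * (c₂ - d₂) / (2 * (1 + 2 * lam)) := by
    rw [eq_div_iff (by simpa using hmC)]
    linear_combination (hf3 - hg3') / 2
  obtain ⟨h, hh, hha⟩ : ∃ h : ℝ, |h| ≤ 1 / (2 * (1 + 2 * lam)) ∧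
      (1 - μ : ℂ) * a 2 ^ 2 = t * h * (c₂ + d₂) := by
    rcases eq_or_ne K 0 with hK0 | hK0
    · have hμ1 : μ = 1 := by
        rw [hK0, abs_zero, mul_zero] at hμ
        linarith [abs_nonpos_iff.1 hμ]
      exact ⟨0, by simpa using hm.le, by simp [hμ1]⟩
    · refine ⟨4 * (1 - μ) / K, ?_, ?_⟩
      · rw [abs_div, div_le_iff₀ (abs_pos.2 hK0), abs_mul, abs_sub_comm, abs_of_pos four_pos]
        calc 4 * |μ - 1| ≤ 4 * (1 / (8 * (1 + 2 * lam)) * |K|) := by gcongr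
          _ = _ := by field_simp; norm_num
      · have hK0C : (K : ℂ) ≠ 0 := by exact_mod_cast hK0
        push_cast
        field_simp
        linear_combination (1 - μ : ℂ) * hsum
  have hfin : a 3 - μ * a 2 ^ 2 = t * ((h + (1 / (2 * (1 + 2 * lam)) : ℝ) : ℂ) * c₂
      + (h - (1 / (2 * (1 + 2 * lam)) : ℝ) : ℂ) * d₂) := by
    push_cast
    linear_combination hdiff + hha
  rw [hfin, norm_mul, Complex.norm_real, Real.norm_of_nonneg ht0.le]
  calc t * _ ≤ t * (2 * (1 / (2 * (1 + 2 * lam)))) := by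
        gcongr
        exact norm_add_mul_sub_mul_le hc hd hh
    _ = t / (1 + 2 * lam) := by field_simp
end

section
/- Let λ ≥ 0, t ∈ (√2/2, 1] with (1+λ)² − 4(λ+λ²)t² ≠ 0, and let a₂, c₁, c₂, d₁, d₂ be complex numbers with |c₂| ≤ 1, |d₂| ≤ 1 satisfying (1+λ)·a₂ = 2t·c₁, −(1+λ)·a₂ = 2t·d₁, and (2(1+λ) − (4t²−1)(1+λ)²/(2t²))·a₂² = 2t·(c₂ + d₂). Then |a₂| ≤ 2t√(2t) / √(|(1+λ)² − 4(λ+λ²)t²|). -/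
theorem a2_bound_step (lam t : ℝ) (hlam : 0 ≤ lam)
    (ht : t ∈ Set.Ioc (Real.sqrt 2 / 2) 1)
    (hne : (1 + lam) ^ 2 - 4 * (lam + lam ^ 2) * t ^ 2 ≠ 0)
    (a2 c1 c2 d1 d2 : ℂ) (hc2 : ‖c2‖ ≤ 1) (hd2 : ‖d2‖ ≤ 1)
    (h9 : (1 + (lam : ℂ)) * a2 = 2 * (t : ℂ) * c1)
    (h11 : -((1 + (lam : ℂ)) * a2) = 2 * (t : ℂ) * d1)
    (h17 : (2 * (1 + (lam : ℂ)) -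
        (4 * (t : ℂ) ^ 2 - 1) * (1 + (lam : ℂ)) ^ 2 / (2 * (t : ℂ) ^ 2)) * a2 ^ 2 =
      2 * (t : ℂ) * (c2 + d2)) :
    ‖a2‖ ≤ 2 * t * Real.sqrt (2 * t) /
      Real.sqrt |(1 + lam) ^ 2 - 4 * (lam + lam ^ 2) * t ^ 2| := by
  have ht0 : 0 < t := lt_trans (by positivity) ht.1
  have htC : (t : ℂ) ≠ 0 := by exact_mod_cast ht0.ne'
  set D : ℝ := (1 + lam) ^ 2 - 4 * (lam + lam ^ 2) * t ^ 2 with hD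
  have hDpos : 0 < |D| := abs_pos.mpr hne
  have key : (D : ℂ) * a2 ^ 2 = ((4 * t ^ 3 : ℝ) : ℂ) * (c2 + d2) := by
    rw [hD]
    push_cast
    field_simp at h17
    linear_combination h17
  have hnorm : |D| * ‖a2‖ ^ 2 = 4 * t ^ 3 * ‖c2 + d2‖ := by
    have h := congrArg norm key
    rwa [norm_mul, norm_mul, norm_pow, Complex.norm_real, Complex.norm_real,
      Real.norm_eq_abs, Real.norm_of_nonneg (by positivity)] at h
  have hsum : ‖c2 + d2‖ ≤ 2 := by linarith [norm_add_le c2 d2]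
  have hbound : ‖a2‖ ^ 2 * |D| ≤ (2 * t) ^ 2 * (2 * t) := by
    have := mul_le_mul_of_nonneg_left hsum (by positivity : 0 ≤ 4 * t ^ 3)
    linarith
  rw [le_div_iff₀ (Real.sqrt_pos.mpr hDpos)]
  refine (sq_le_sq₀ (by positivity) (by positivity)).mp ?_
  rwa [mul_pow, mul_pow, Real.sq_sqrt hDpos.le, Real.sq_sqrt (by positivity)]
end

section
/- Let λ ≥ 0, t ≠ 0 real, and let a₂, a₃, c₁, c₂, d₁, d₂ be complex numbers satisfying (1+λ)·a₂ = 2t·c₁, 2(1+2λ)·a₃ − (1+3λ)·a₂² = 2t·c₂ + (4t²−1)·c₁², −(1+λ)·a₂ = 2t·d₁, and 2(1+2λ)·(2a₂² − a₃) − (1+3λ)·a₂² = 2t·d₂ + (4t²−1)·d₁². Then a₃ = (4t²/(2(1+λ)²))·(c₁² + d₁²) + (2t/(4(1+2λ)))·(c₂ − d₂). Moreover, if |c₁| ≤ 1, |c₂| ≤ 1, |d₁| ≤ 1, |d₂| ≤ 1 and t > 0, then |a₃| ≤ 4t²/(1+λ)² + t/(1+2λ). -/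
theorem a3_formula_and_bound (lam t : ℝ) (hlam : 0 ≤ lam) (ht : t ≠ 0)
    (a2 a3 c1 c2 d1 d2 : ℂ)
    (h9 : (1 + (lam : ℂ)) * a2 = 2 * (t : ℂ) * c1)
    (h10 : 2 * (1 + 2 * (lam : ℂ)) * a3 - (1 + 3 * (lam : ℂ)) * a2 ^ 2 =
      2 * (t : ℂ) * c2 + (4 * (t : ℂ) ^ 2 - 1) * c1 ^ 2)
    (h11 : -((1 + (lam : ℂ)) * a2) = 2 * (t : ℂ) * d1)
    (h12 : 2 * (1 + 2 * (lam : ℂ)) * (2 * a2 ^ 2 - a3) - (1 + 3 * (lam : ℂ)) * a2 ^ 2 =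
      2 * (t : ℂ) * d2 + (4 * (t : ℂ) ^ 2 - 1) * d1 ^ 2) :
    a3 = (4 * (t : ℂ) ^ 2 / (2 * (1 + (lam : ℂ)) ^ 2)) * (c1 ^ 2 + d1 ^ 2) +
        (2 * (t : ℂ) / (4 * (1 + 2 * (lam : ℂ)))) * (c2 - d2) ∧
    (‖c1‖ ≤ 1 → ‖c2‖ ≤ 1 → ‖d1‖ ≤ 1 → ‖d2‖ ≤ 1 → 0 < t →
      ‖a3‖ ≤ 4 * t ^ 2 / (1 + lam) ^ 2 + t / (1 + 2 * lam)) := by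
  have hA : (1 + (lam : ℂ)) ≠ 0 := by
    exact_mod_cast (by positivity : (1 + lam : ℝ) ≠ 0)
  have hB : (1 + 2 * (lam : ℂ)) ≠ 0 := by
    exact_mod_cast (by positivity : (1 + 2 * lam : ℝ) ≠ 0)
  have ht' : (2 * (t : ℂ)) ≠ 0 := by
    exact_mod_cast (by positivity : (2 * t : ℝ) ≠ 0)
  have hd : d1 = -c1 := mul_left_cancel₀ ht' (by linear_combination -h11 - h9)
  have ha2 : a2 = 2 * (t : ℂ) * c1 / (1 + (lam : ℂ)) := by
    rw [eq_div_iff hA, mul_comm, h9]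
  have ha3 : a3 = a2 ^ 2 + 2 * (t : ℂ) * (c2 - d2) / (4 * (1 + 2 * (lam : ℂ))) := by
    rw [← sub_eq_iff_eq_add', eq_div_iff (mul_ne_zero (by norm_num) hB)]
    subst hd
    linear_combination h10 - h12
  have hformula : a3 = (4 * (t : ℂ) ^ 2 / (2 * (1 + (lam : ℂ)) ^ 2)) * (c1 ^ 2 + d1 ^ 2) +
      (2 * (t : ℂ) / (4 * (1 + 2 * (lam : ℂ)))) * (c2 - d2) := by
    rw [ha3, ha2, hd]
    field_simp
    ring
  refine ⟨hformula, fun hc1 hc2 hd1 hd2 htpos => ?_⟩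
  have hp : ‖4 * (t : ℂ) ^ 2 / (2 * (1 + (lam : ℂ)) ^ 2)‖ = 4 * t ^ 2 / (2 * (1 + lam) ^ 2) := by
    have h := Complex.norm_of_nonneg (r := 4 * t ^ 2 / (2 * (1 + lam) ^ 2)) (by positivity)
    simpa only [Complex.ofReal_div, Complex.ofReal_mul, Complex.ofReal_pow, Complex.ofReal_add,
      Complex.ofReal_one, Complex.ofReal_ofNat] using h
  have hq : ‖2 * (t : ℂ) / (4 * (1 + 2 * (lam : ℂ)))‖ = 2 * t / (4 * (1 + 2 * lam)) := by
    have h := Complex.norm_of_nonneg (r := 2 * t / (4 * (1 + 2 * lam))) (by positivity)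
    simpa only [Complex.ofReal_div, Complex.ofReal_mul, Complex.ofReal_add,
      Complex.ofReal_one, Complex.ofReal_ofNat] using h
  have hsq : ‖c1 ^ 2 + d1 ^ 2‖ ≤ 2 := by
    refine (norm_add_le _ _).trans ?_
    rw [norm_pow, norm_pow]
    linarith [pow_le_one₀ (n := 2) (norm_nonneg c1) hc1,
      pow_le_one₀ (n := 2) (norm_nonneg d1) hd1]
  have hsub : ‖c2 - d2‖ ≤ 2 := (norm_sub_le _ _).trans (by linarith)
  calc ‖a3‖ ≤ 4 * t ^ 2 / (2 * (1 + lam) ^ 2) * ‖c1 ^ 2 + d1 ^ 2‖ +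
        2 * t / (4 * (1 + 2 * lam)) * ‖c2 - d2‖ := by
        rw [hformula, ← hp, ← hq, ← norm_mul, ← norm_mul]
        exact norm_add_le _ _
    _ ≤ 4 * t ^ 2 / (2 * (1 + lam) ^ 2) * 2 + 2 * t / (4 * (1 + 2 * lam)) * 2 := by gcongr
    _ = 4 * t ^ 2 / (1 + lam) ^ 2 + t / (1 + 2 * lam) := by
        field_simp
        ring
end
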